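/- arXiv:2601.03180 — 3 statements merged into one kernel-verified Lean document; each statement's English description precedes it below -/
import Mathlib

section
/- Let Σ be a finitary signature in which all operation symbols have arity 0 or 1, let E be a set of quantitative equations over Σ, and let X be an extended metric space. On the set T_Σ|X| of terms, define the extended pseudometric d̄_X(t,t') = inf{ε ≥ 0 : every quantitative Σ-algebra satisfying all equations of E satisfies t =_ε t'} (with inf ∅ = ∞), and let d_X^E = d_X^* ∧ d̄_X be the meet of the free-algebra metric d_X^* and d̄_X in the lattice of extended pseudometrics on T_Σ|X| (computed by the chain-infimum construction). Then every operation of the term algebra T_Σ|X| is nonexpanding with respect to d_X^E. -/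
open ENNReal NNReal

/-- Σ-terms with variables in `X`, for a finitary signature `Sg`. -/
inductive Term (Sg : ℕ → Type) (X : Type) : Type
  | var : X → Term Sg X
  | op : ∀ {n : ℕ}, Sg n → (Fin n → Term Sg X) → Term Sg X

/-- The homomorphic extension of a valuation `f : X → A` to terms. -/
def evalT {Sg : ℕ → Type} {X : Type} {A : Type}
    (ops : ∀ n, Sg n → (Fin n → A) → A) (f : X → A) : Term Sg X → A
  | .var x => f x
  | .op σ t => ops _ σ (fun i => evalT ops f (t i))

/-- `d` is an extended metric on `X`. -/
def IsEMet {X : Type} (d : X → X → ℝ≥0∞) : Prop :=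
  (∀ x, d x x = 0) ∧ (∀ x y, d x y = 0 → x = y) ∧ (∀ x y, d x y = d y x) ∧
    (∀ x y z, d x z ≤ d x y + d y z)

/-- `(A, dA, ops)` is a quantitative `Σ`-algebra: `dA` is an extended metric and every
operation is nonexpanding for the maximum metric on powers. -/
def IsQAlg {Sg : ℕ → Type} {A : Type} (dA : A → A → ℝ≥0∞)
    (ops : ∀ n, Sg n → (Fin n → A) → A) : Prop :=
  IsEMet dA ∧ ∀ n (σ : Sg n) (a b : Fin n → A),
    dA (ops n σ a) (ops n σ b) ≤ ⨆ i : Fin n, dA (a i) (b i)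

/-- A quantitative equation `lhs =_eps rhs` over a finite set of variables. -/
structure QEq (Sg : ℕ → Type) where
  k : ℕ
  lhs : Term Sg (Fin k)
  rhs : Term Sg (Fin k)
  eps : ℝ≥0

/-- The algebra `(A, dA, ops)` satisfies the quantitative equation `t =_ε t'`. -/
def SatQ {Sg : ℕ → Type} {A : Type} (dA : A → A → ℝ≥0∞)
    (ops : ∀ n, Sg n → (Fin n → A) → A) {V : Type} (t t' : Term Sg V) (ε : ℝ≥0∞) : Prop :=
  ∀ f : V → A, dA (evalT ops f t) (evalT ops f t') ≤ ε

/-- `d̄_X (t, t') = inf { ε : every quantitative Σ-algebra satisfying all equations of E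
satisfies t =_ε t' }` (the infimum of the empty set being `∞`). -/
noncomputable def dBar (Sg : ℕ → Type) (E : Set (QEq Sg)) {X : Type}
    (t t' : Term Sg X) : ℝ≥0∞ :=
  sInf {ε : ℝ≥0∞ | ∀ (A : Type) (dA : A → A → ℝ≥0∞) (ops : ∀ n, Sg n → (Fin n → A) → A),
    IsQAlg dA ops → (∀ e ∈ E, SatQ dA ops e.lhs e.rhs (e.eps : ℝ≥0∞)) →
    SatQ dA ops t t' ε}

open scoped Classical in
/-- The metric `d_X^*` on terms: distances of variables are taken from `X`, composite
terms with the same head symbol get the maximum of the distances of their children, and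
all other pairs (non-similar terms) have distance `∞`. -/
noncomputable def dStar {Sg : ℕ → Type} {X : Type} (dX : X → X → ℝ≥0∞) :
    Term Sg X → Term Sg X → ℝ≥0∞
  | .var x, .var y => dX x y
  | .op (n := n) σ t, .op (n := m) τ t' =>
      if h : n = m then
        (if HEq σ τ then ⨆ i : Fin n, dStar dX (t i) (t' (Fin.cast h i)) else ∞)
      else ∞
  | _, _ => ∞

/-- The meet of two extended pseudometrics, via the chain-infimum construction. -/
noncomputable def pmeet {X : Type} (d' d'' : X → X → ℝ≥0∞) (x y : X) : ℝ≥0∞ :=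
  sInf {r : ℝ≥0∞ | ∃ (n : ℕ) (s : ℕ → X), s 0 = x ∧ s n = y ∧
    r = ∑ i ∈ Finset.range n, min (d' (s i) (s (i + 1))) (d'' (s i) (s (i + 1)))}

theorem dStar_op_one {Sg : ℕ → Type} {X : Type} (dX : X → X → ℝ≥0∞) (σ : Sg 1)
    (t t' : Fin 1 → Term Sg X) :
    dStar dX (Term.op σ t) (Term.op σ t') = dStar dX (t 0) (t' 0) := by
  simp [dStar]

theorem dBar_op_le {Sg : ℕ → Type} (E : Set (QEq Sg)) {X : Type} (σ : Sg 1)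
    (t t' : Fin 1 → Term Sg X) :
    dBar Sg E (Term.op σ t) (Term.op σ t') ≤ dBar Sg E (t 0) (t' 0) := by
  refine sInf_le_sInf fun ε hε A dA ops hA hE f => ?_
  refine (hA.2 1 σ _ _).trans (iSup_le fun i => ?_)
  rw [Subsingleton.elim i 0]
  exact hε A dA ops hA hE f

theorem pmeet_self {X : Type} (d' d'' : X → X → ℝ≥0∞) (x : X) : pmeet d' d'' x x = 0 :=
  le_antisymm (sInf_le ⟨0, fun _ => x, rfl, rfl, by simp⟩) bot_le

/-- A map that is nonexpanding for two distances is nonexpanding for their meet. -/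
theorem pmeet_map_le {X Y : Type} {d' d'' : X → X → ℝ≥0∞} {e' e'' : Y → Y → ℝ≥0∞} (g : X → Y)
    (h' : ∀ x y, e' (g x) (g y) ≤ d' x y) (h'' : ∀ x y, e'' (g x) (g y) ≤ d'' x y) (x y : X) :
    pmeet e' e'' (g x) (g y) ≤ pmeet d' d'' x y := by
  refine le_sInf ?_
  rintro r ⟨n, s, rfl, rfl, rfl⟩
  refine le_trans (sInf_le ⟨n, g ∘ s, rfl, rfl, rfl⟩) ?_
  exact Finset.sum_le_sum fun i _ => min_le_min (h' _ _) (h'' _ _)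

/-- For a signature with arities 0 and 1 only, every operation of the term
algebra `T_Σ|X|` is nonexpanding with respect to `d_X^E = d_X^* ∧ d̄_X`. -/
theorem term_ops_nonexpanding_unary {Sg : ℕ → Type} (hSg : ∀ n, 2 ≤ n → IsEmpty (Sg n))
    (E : Set (QEq Sg)) {X : Type} (dX : X → X → ℝ≥0∞) (hdX : IsEMet dX) :
    ∀ n (σ : Sg n) (t t' : Fin n → Term Sg X),
      pmeet (dStar dX) (dBar Sg E) (Term.op σ t) (Term.op σ t') ≤
        ⨆ i : Fin n, pmeet (dStar dX) (dBar Sg E) (t i) (t' i) := by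
  intro n σ t t'
  match n, σ, t, t' with
  | 0, σ, t, t' =>
    rw [Subsingleton.elim t t', pmeet_self]
    exact bot_le
  | 1, σ, t, t' =>
    refine le_iSup_of_le 0 ?_
    have h := pmeet_map_le (d' := dStar dX) (d'' := dBar Sg E) (e' := dStar dX)
      (e'' := dBar Sg E) (fun s : Term Sg X => Term.op σ fun _ => s)
      (fun x y => (dStar_op_one dX σ _ _).le) (fun x y => dBar_op_le E σ _ _) (t 0) (t' 0)
    have h_const (u : Fin 1 → Term Sg X) : (fun _ => u 0) = u :=
      funext fun i => congrArg u (Subsingleton.elim 0 i)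
    simpa only [h_const] using h
  | n + 2, σ, _, _ => exact ((hSg (n + 2) (by omega)).false σ).elim
end

section
/- Let Σ be a finitary signature with all arities 0 or 1, E a set of quantitative equations over Σ, and X an extended metric space. Let A = (T_Σ|X|, d_X^E) be the term algebra with the pseudometric d_X^E = d_X^* ∧ d̄_X, and let q : A → A/∼ be its metric reflection (identifying terms at distance 0), equipped with the induced quantitative Σ-algebra structure. Then: (a) A/∼ satisfies every quantitative equation of E; (b) the map q ∘ η_X : X → A/∼ (η_X being the insertion of variables) is nonexpanding; and (c) A/∼ is the free algebra on X in the variety presented by E: for every quantitative Σ-algebra B satisfying all equations of E and every nonexpanding map f : X → B there is a unique nonexpanding homomorphism h : A/∼ → B with h ∘ (q ∘ η_X) = f. -/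
open ENNReal NNReal

theorem evalT_evalT {Sg : ℕ → Type} {V X A : Type} (ops : ∀ n, Sg n → (Fin n → A) → A)
    (v : X → A) (g : V → Term Sg X) (t : Term Sg V) :
    evalT ops v (evalT (fun _ => Term.op) g t) = evalT ops (fun i => evalT ops v (g i)) t := by
  induction t with
  | var x => rfl
  | op σ t ih => simp only [evalT, ih]

theorem evalT_comp_hom {Sg : ℕ → Type} {V A B : Type} {opsA : ∀ n, Sg n → (Fin n → A) → A}
    {opsB : ∀ n, Sg n → (Fin n → B) → B} {h : A → B}
    (hh : ∀ n (σ : Sg n) (a : Fin n → A), h (opsA n σ a) = opsB n σ (fun i => h (a i)))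
    (v : V → A) (t : Term Sg V) :
    h (evalT opsA v t) = evalT opsB (fun x => h (v x)) t := by
  induction t with
  | var x => rfl
  | op σ t ih => simp only [evalT, hh, ih]

theorem pmeet_le_min {X : Type} (d' d'' : X → X → ℝ≥0∞) (x y : X) :
    pmeet d' d'' x y ≤ min (d' x y) (d'' x y) :=
  sInf_le ⟨1, fun i => if i = 0 then x else y, by simp, by simp, by simp⟩

/-- `pmeet d' d''` dominates every pseudometric lying below both `d'` and `d''`. -/
theorem le_pmeet {X : Type} {d d' d'' : X → X → ℝ≥0∞} (h0 : ∀ x, d x x = 0)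
    (htri : ∀ x y z, d x z ≤ d x y + d y z) (h' : ∀ x y, d x y ≤ d' x y)
    (h'' : ∀ x y, d x y ≤ d'' x y) (x y : X) : d x y ≤ pmeet d' d'' x y := by
  refine le_sInf ?_
  rintro _ ⟨n, s, rfl, rfl, rfl⟩
  induction n with
  | zero => simp [h0]
  | succ n ih =>
    rw [Finset.sum_range_succ]
    exact (htri _ (s n) _).trans (add_le_add ih (le_min (h' _ _) (h'' _ _)))

theorem dist_evalT_le_dStar {Sg : ℕ → Type} {X B : Type} {dX : X → X → ℝ≥0∞}
    {dB : B → B → ℝ≥0∞} {opsB : ∀ n, Sg n → (Fin n → B) → B} (hB : IsQAlg dB opsB)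
    {f : X → B} (hf : ∀ x y, dB (f x) (f y) ≤ dX x y) (t t' : Term Sg X) :
    dB (evalT opsB f t) (evalT opsB f t') ≤ dStar dX t t' := by
  induction t generalizing t' with
  | var x =>
    cases t' with
    | var y => simpa only [evalT, dStar] using hf x y
    | op τ t' => simp [dStar]
  | @op n σ t ih =>
    cases t' with
    | var y => simp [dStar]
    | @op m τ t' =>
      rw [dStar]
      split_ifs with h hστ
      · subst h
        obtain rfl := eq_of_heq hστ
        exact (hB.2 n σ _ _).trans (iSup_mono fun i => ih i (t' i))
      · exact le_top
      · exact le_top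

theorem dist_evalT_le_dBar {Sg : ℕ → Type} {E : Set (QEq Sg)} {X B : Type}
    {dB : B → B → ℝ≥0∞} {opsB : ∀ n, Sg n → (Fin n → B) → B} (hB : IsQAlg dB opsB)
    (hE : ∀ e ∈ E, SatQ dB opsB e.lhs e.rhs (e.eps : ℝ≥0∞)) (f : X → B) (t t' : Term Sg X) :
    dB (evalT opsB f t) (evalT opsB f t') ≤ dBar Sg E t t' :=
  le_sInf fun _ hε => hε B dB opsB hB hE f

theorem dBar_subst_le {Sg : ℕ → Type} {E : Set (QEq Sg)} {X : Type} {e : QEq Sg} (he : e ∈ E)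
    (g : Fin e.k → Term Sg X) :
    dBar Sg E (evalT (fun _ => Term.op) g e.lhs) (evalT (fun _ => Term.op) g e.rhs) ≤ e.eps :=
  sInf_le fun A dA ops _ hE v => by
    simpa only [evalT_evalT] using hE e he (fun i => evalT ops v (g i))

/-- For a signature with arities 0 and 1 only and a set `E` of quantitative
equations, let `q : (T_Σ|X|, d_X^E) → Q` be the metric reflection of the term algebra,
equipped with the induced quantitative algebra structure. Then (a) `Q` satisfies every
equation of `E`, (b) the composite `q ∘ η_X` is nonexpanding, and (c) `Q` is the free
algebra on `X` in the variety presented by `E`. -/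
theorem free_algebra_unary {Sg : ℕ → Type} (hSg : ∀ n, 2 ≤ n → IsEmpty (Sg n))
    (E : Set (QEq Sg)) {X : Type} (dX : X → X → ℝ≥0∞) (hdX : IsEMet dX)
    -- the metric reflection q : (T_Σ|X|, d_X^E) → Q :
    (Q : Type) (dQ : Q → Q → ℝ≥0∞) (q : Term Sg X → Q)
    (hq_surj : Function.Surjective q)
    (hq_pres : ∀ t t' : Term Sg X,
      dQ (q t) (q t') = pmeet (dStar dX) (dBar Sg E) t t')
    (hQ_sep : ∀ u v : Q, dQ u v = 0 → u = v)
    -- the induced quantitative Σ-algebra structure on Q (q is a homomorphism) :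
    (opsQ : ∀ n, Sg n → (Fin n → Q) → Q)
    (hq_hom : ∀ n (σ : Sg n) (a : Fin n → Term Sg X),
      opsQ n σ (fun i => q (a i)) = q (Term.op σ a))
    (hopsQ : ∀ n (σ : Sg n) (a b : Fin n → Q),
      dQ (opsQ n σ a) (opsQ n σ b) ≤ ⨆ i : Fin n, dQ (a i) (b i)) :
    -- (a) Q satisfies every equation of E :
    (∀ e ∈ E, SatQ dQ opsQ e.lhs e.rhs (e.eps : ℝ≥0∞)) ∧
    -- (b) q ∘ η_X is nonexpanding :
    (∀ x y : X, dQ (q (Term.var x)) (q (Term.var y)) ≤ dX x y) ∧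
    -- (c) Q is the free algebra on X in the variety presented by E :
    (∀ (B : Type) (dB : B → B → ℝ≥0∞) (opsB : ∀ n, Sg n → (Fin n → B) → B),
      IsQAlg dB opsB → (∀ e ∈ E, SatQ dB opsB e.lhs e.rhs (e.eps : ℝ≥0∞)) →
      ∀ f : X → B, (∀ x y : X, dB (f x) (f y) ≤ dX x y) →
      ∃! h : Q → B,
        (∀ u v : Q, dB (h u) (h v) ≤ dQ u v) ∧
        (∀ n (σ : Sg n) (b : Fin n → Q), h (opsQ n σ b) = opsB n σ (fun i => h (b i))) ∧
        (∀ x : X, h (q (Term.var x)) = f x)) := by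
  refine ⟨fun e he f => ?_, fun x y => ?_, fun B dB opsB hB hE f hf => ?_⟩
  · choose g hg using fun i => hq_surj (f i)
    obtain rfl : (fun i => q (g i)) = f := funext hg
    rw [← evalT_comp_hom (opsA := fun _ => Term.op) (h := q) (fun n σ a => (hq_hom n σ a).symm),
      ← evalT_comp_hom (opsA := fun _ => Term.op) (h := q) (fun n σ a => (hq_hom n σ a).symm),
      hq_pres]
    exact (pmeet_le_min _ _ _ _).trans ((min_le_right _ _).trans (dBar_subst_le he g))
  · rw [hq_pres]
    refine (pmeet_le_min _ _ _ _).trans ((min_le_left _ _).trans ?_)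
    rw [dStar]
  · have key (t t' : Term Sg X) :
        dB (evalT opsB f t) (evalT opsB f t') ≤ dQ (q t) (q t') := by
      rw [hq_pres]
      exact le_pmeet (d := fun t t' => dB (evalT opsB f t) (evalT opsB f t'))
        (fun _ => hB.1.1 _) (fun _ _ _ => hB.1.2.2.2 _ _ _)
        (dist_evalT_le_dStar hB hf) (dist_evalT_le_dBar hB hE f) t t'
    choose r hr using hq_surj
    have hrq (t : Term Sg X) : evalT opsB f (r (q t)) = evalT opsB f t := by
      refine hB.1.2.1 _ _ (le_antisymm ((key _ _).trans ?_) zero_le)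
      rw [hr, hq_pres, pmeet_self]
    refine ⟨fun u => evalT opsB f (r u), ⟨fun u v => ?_, fun n σ b => ?_, fun x => hrq _⟩, ?_⟩
    · simpa only [hr] using key (r u) (r v)
    · have h := hrq (Term.op σ fun i => r (b i))
      rw [← hq_hom] at h
      simpa only [hr, evalT] using h
    · rintro h ⟨-, hop, hvar⟩
      have hq (t : Term Sg X) : h (q t) = evalT opsB f t := by
        induction t with
        | var x => exact hvar x
        | op σ t ih => simp only [← hq_hom, hop, ih, evalT]
      funext u
      simpa only [hr] using hq (r u)
end

section
/- Let Σ be a finitary signature and E a set of ordinary equations over Σ. For an extended metric space X, write T_E X for the metric reflection of (T_Σ|X|, d_X^@) with reflection map q_X, and for a set S write T_E S for the construction applied to S with the discrete metric, with reflection map q_S; for a map g between sets, T_E g denotes the induced nonexpanding map between reflections. Let Y be an extended metric space and f : T_E|X| → Y a nonexpanding map such that for every δ > 0, with Δ_δ X = {(x,x') ∈ X × X : d_X(x,x') ≤ δ} and projections l_δ, r_δ : Δ_δ X → |X|, one has d_Y(f(T_E l_δ(a)), f(T_E r_δ(a))) ≤ δ for all a ∈ T_E(Δ_δ X). Then there exists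 a nonexpanding map f' : T_E X → Y with f'(q_X(t)) = f(q_{|X|}(t)) for all terms t ∈ T_Σ|X|. -/
open ENNReal NNReal

/-- An ordinary equation `lhs = rhs` over a finite set of variables. -/
structure OrdEq (Sg : ℕ → Type) where
  k : ℕ
  lhs : Term Sg (Fin k)
  rhs : Term Sg (Fin k)

/-- The Σ-algebra `(A, ops)` satisfies the ordinary equation `t = t'`: every valuation's
homomorphic extension sends `t` and `t'` to the same element. -/
def SatOrd {Sg : ℕ → Type} {A : Type} (ops : ∀ n, Sg n → (Fin n → A) → A)
    {V : Type} (t t' : Term Sg V) : Prop :=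
  ∀ f : V → A, evalT ops f t = evalT ops f t'

/-- `t ≈ t'` iff every Σ-algebra satisfying all equations of `E` satisfies `t = t'`
under every valuation. -/
def approxE (Sg : ℕ → Type) (E : Set (OrdEq Sg)) {X : Type} (t t' : Term Sg X) : Prop :=
  ∀ (A : Type) (ops : ∀ n, Sg n → (Fin n → A) → A),
    (∀ e ∈ E, SatOrd ops e.lhs e.rhs) → SatOrd ops t t'

/-- The extended pseudometric `d_X^@`:
`d_X^@ (u, v) = inf Σ_{i=0}^{n} d_X^* (s 2i, s (2i+1))`, the infimum ranging over all
sequences of terms `u = s 0, s 1, …, s (2n+1) = v` with `s (2i-1) ≈ s (2i)` for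
`i = 1, …, n`. -/
noncomputable def dAt (Sg : ℕ → Type) (E : Set (OrdEq Sg)) {X : Type}
    (dX : X → X → ℝ≥0∞) (u v : Term Sg X) : ℝ≥0∞ :=
  sInf {r : ℝ≥0∞ | ∃ (n : ℕ) (s : ℕ → Term Sg X), s 0 = u ∧ s (2 * n + 1) = v ∧
    (∀ i, 1 ≤ i → i ≤ n → approxE Sg E (s (2 * i - 1)) (s (2 * i))) ∧
    r = ∑ i ∈ Finset.range (n + 1), dStar dX (s (2 * i)) (s (2 * i + 1))}

/-- The homomorphic relabeling of variables along a map `v : V → W`. -/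
def renameT {Sg : ℕ → Type} {V W : Type} (v : V → W) : Term Sg V → Term Sg W
  | .var x => .var (v x)
  | .op σ t => .op σ (fun i => renameT v (t i))

open scoped Classical in
/-- The discrete extended metric on a set: all nonzero distances are `∞`. -/
noncomputable def ddisc {α : Type} (x y : α) : ℝ≥0∞ := if x = y then 0 else ∞

theorem dStar_self {Sg : ℕ → Type} {X : Type} {d : X → X → ℝ≥0∞} (hd : ∀ x, d x x = 0)
    (t : Term Sg X) : dStar d t t = 0 := by
  induction t with
  | var x => simp [dStar, hd]
  | op σ t ih => simp [dStar, ih]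

theorem ddisc_self {α : Type} (x : α) : ddisc x x = 0 := by simp [ddisc]

/-- Terms at finite distance at most `δ` arise by relabeling a single term whose variables
are pairs of distance at most `δ`. -/
theorem exists_renameT_of_dStar_le {Sg : ℕ → Type} {X : Type} {dX : X → X → ℝ≥0∞}
    {δ : ℝ≥0∞} (hδ : δ ≠ ∞) (t t' : Term Sg X) (h : dStar dX t t' ≤ δ) :
    ∃ a : Term Sg {p : X × X // dX p.1 p.2 ≤ δ},
      renameT (fun p => p.1.1) a = t ∧ renameT (fun p => p.1.2) a = t' := by
  induction t generalizing t' with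
  | var x =>
    cases t' with
    | var y => exact ⟨.var ⟨(x, y), by simpa [dStar] using h⟩, rfl, rfl⟩
    | op τ s => simp [dStar, hδ] at h
  | @op n σ t ih =>
    cases t' with
    | var y => simp [dStar, hδ] at h
    | @op m τ s =>
      by_cases hnm : n = m
      · subst hnm
        by_cases hστ : σ = τ
        · subst hστ
          simp only [dStar, dite_true, heq_eq_eq, if_true, iSup_le_iff, Fin.cast_eq_self] at h
          choose a hl hr using fun i => ih i (s i) (h i)
          exact ⟨.op σ a, by simp [renameT, hl], by simp [renameT, hr]⟩
        · simp [dStar, hστ, hδ] at h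
      · simp [dStar, hnm, hδ] at h

theorem dAt_self {Sg : ℕ → Type} (E : Set (OrdEq Sg)) {X : Type} {d : X → X → ℝ≥0∞}
    (hd : ∀ x, d x x = 0) (t : Term Sg X) : dAt Sg E d t t = 0 := by
  refine le_antisymm (sInf_le ⟨0, fun _ => t, rfl, rfl, ?_, ?_⟩) zero_le
  · intro i h1 h0
    omega
  · simp [dStar_self hd]

theorem dAt_eq_zero_of_approxE {Sg : ℕ → Type} {E : Set (OrdEq Sg)} {X : Type}
    {d : X → X → ℝ≥0∞} (hd : ∀ x, d x x = 0) {t t' : Term Sg X} (h : approxE Sg E t t') :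
    dAt Sg E d t t' = 0 := by
  refine le_antisymm
    (sInf_le ⟨1, fun k => if k ≤ 1 then t else t', by simp, by simp, ?_, ?_⟩) zero_le
  · intro i h1 h2
    obtain rfl : i = 1 := le_antisymm h2 h1
    simpa using h
  · simp [Finset.sum_range_succ, dStar_self hd]

/-- A map on terms that is nonexpanding for `d_X^*` and identifies `≈`-related terms is
nonexpanding for `d_X^@`. -/
theorem le_dAt {Sg : ℕ → Type} {E : Set (OrdEq Sg)} {X Y : Type} {d : X → X → ℝ≥0∞}
    {dY : Y → Y → ℝ≥0∞} (htri : ∀ x y z, dY x z ≤ dY x y + dY y z) (g : Term Sg X → Y)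
    (hstar : ∀ t t', dY (g t) (g t') ≤ dStar d t t')
    (hg : ∀ t t', approxE Sg E t t' → g t = g t') (u v : Term Sg X) :
    dY (g u) (g v) ≤ dAt Sg E d u v := by
  refine le_sInf ?_
  rintro r ⟨n, s, rfl, rfl, hs, rfl⟩
  induction n with
  | zero => simpa using hstar (s 0) (s 1)
  | succ n ih =>
    have happ : g (s (2 * n + 1)) = g (s (2 * (n + 1))) :=
      hg _ _ (hs (n + 1) (by omega) le_rfl)
    rw [Finset.sum_range_succ]
    refine (htri _ (g (s (2 * n + 1))) _).trans (add_le_add ?_ ?_)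
    · exact ih fun i h1 h2 => hs i h1 (by omega)
    · rw [happ]
      exact hstar _ _

/-- For a set `E` of ordinary equations, write `T_E X` for the metric
reflection of `(T_Σ|X|, d_X^@)`. If a nonexpanding map `f : T_E|X| → Y` satisfies
`d_Y (f (T_E l_δ a), f (T_E r_δ a)) ≤ δ` for all `δ > 0` and `a ∈ T_E (Δ_δ X)`, then `f`
factorizes through `T_E i_X` via a nonexpanding map `f' : T_E X → Y`. -/
theorem factorization_through_TEiX_ordinary {Sg : ℕ → Type} (E : Set (OrdEq Sg))
    {X : Type} (dX : X → X → ℝ≥0∞) (hdX : IsEMet dX)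
    -- T_E X : the metric reflection of (T_Σ|X|, d_X^@) built from the metric dX :
    (QX : Type) (dQX : QX → QX → ℝ≥0∞) (qX : Term Sg X → QX)
    (hqX_surj : Function.Surjective qX)
    (hqX_pres : ∀ t t' : Term Sg X, dQX (qX t) (qX t') = dAt Sg E dX t t')
    (hQX_sep : ∀ u v : QX, dQX u v = 0 → u = v)
    -- T_E |X| : the same construction for the underlying set with the discrete metric :
    (QD : Type) (dQD : QD → QD → ℝ≥0∞) (qD : Term Sg X → QD)
    (hqD_surj : Function.Surjective qD)
    (hqD_pres : ∀ t t' : Term Sg X, dQD (qD t) (qD t') = dAt Sg E ddisc t t')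
    (hQD_sep : ∀ u v : QD, dQD u v = 0 → u = v)
    -- T_E (Δ_δ X) : the construction for the sets Δ_δ X with the discrete metric :
    (QΔ : ℝ≥0∞ → Type) (dQΔ : ∀ δ, QΔ δ → QΔ δ → ℝ≥0∞)
    (qΔ : ∀ δ, Term Sg {p : X × X // dX p.1 p.2 ≤ δ} → QΔ δ)
    (hqΔ_surj : ∀ δ, Function.Surjective (qΔ δ))
    (hqΔ_pres : ∀ δ (t t' : Term Sg {p : X × X // dX p.1 p.2 ≤ δ}),
      dQΔ δ (qΔ δ t) (qΔ δ t') = dAt Sg E ddisc t t')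
    (hQΔ_sep : ∀ δ (u v : QΔ δ), dQΔ δ u v = 0 → u = v)
    -- T_E l_δ and T_E r_δ : the maps induced by the left and right projections :
    (Tl Tr : ∀ δ, QΔ δ → QD)
    (hTl : ∀ δ (t : Term Sg {p : X × X // dX p.1 p.2 ≤ δ}),
      Tl δ (qΔ δ t) = qD (renameT (fun p => p.1.1) t))
    (hTr : ∀ δ (t : Term Sg {p : X × X // dX p.1 p.2 ≤ δ}),
      Tr δ (qΔ δ t) = qD (renameT (fun p => p.1.2) t))
    (hTl_ne : ∀ δ (u v : QΔ δ), dQD (Tl δ u) (Tl δ v) ≤ dQΔ δ u v)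
    (hTr_ne : ∀ δ (u v : QΔ δ), dQD (Tr δ u) (Tr δ v) ≤ dQΔ δ u v)
    -- the nonexpanding map f : T_E|X| → Y :
    {Y : Type} (dY : Y → Y → ℝ≥0∞) (hdY : IsEMet dY)
    (f : QD → Y) (hf_ne : ∀ u v : QD, dY (f u) (f v) ≤ dQD u v)
    -- the hypothesis: d_Y (f (T_E l_δ a), f (T_E r_δ a)) ≤ δ for all δ > 0 :
    (hf : ∀ δ : ℝ≥0∞, 0 < δ → ∀ a : QΔ δ, dY (f (Tl δ a)) (f (Tr δ a)) ≤ δ) :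
    -- conclusion: f factorizes through T_E i_X via a nonexpanding map f' :
    ∃ f' : QX → Y, (∀ u v : QX, dY (f' u) (f' v) ≤ dQX u v) ∧
      ∀ t : Term Sg X, f' (qX t) = f (qD t) := by
  have happ (t t' : Term Sg X) (h : approxE Sg E t t') : f (qD t) = f (qD t') := by
    rw [hQD_sep _ _ ((hqD_pres t t').trans (dAt_eq_zero_of_approxE ddisc_self h))]
  have hstar (t t' : Term Sg X) : dY (f (qD t)) (f (qD t')) ≤ dStar dX t t' := by
    refine ENNReal.le_of_forall_pos_le_add fun ε hε hfin => ?_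
    obtain ⟨a, ha, ha'⟩ := exists_renameT_of_dStar_le
      (ENNReal.add_ne_top.2 ⟨hfin.ne, ENNReal.coe_ne_top⟩) t t'
      (le_self_add (b := (ε : ℝ≥0∞)))
    have hpos : (0 : ℝ≥0∞) < ε := ENNReal.coe_pos.2 hε
    have := hf _ (hpos.trans_le le_add_self) (qΔ _ a)
    rwa [hTl, hTr, ha, ha'] at this
  have hle := le_dAt hdY.2.2.2 (fun t => f (qD t)) hstar happ
  refine ⟨fun u => f (qD (Function.surjInv hqX_surj u)), fun u v => ?_, fun t => ?_⟩
  · refine (hle _ _).trans_eq ?_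
    rw [← hqX_pres, Function.surjInv_eq hqX_surj, Function.surjInv_eq hqX_surj]
  · refine hdY.2.1 _ _ (le_antisymm ((hle _ _).trans_eq ?_) zero_le)
    rw [← hqX_pres, Function.surjInv_eq hqX_surj, hqX_pres, dAt_self E hdX.1]
end
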